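/- arXiv:1102.2157 — 2 statements merged into one kernel-verified Lean document; each statement's English description precedes it below -/
import Mathlib

section
/- For every σ > 5/2 there exists a constant C > 0 such that for every ζ ∈ ℂ \ [0,∞) with 0 < |ζ| ≤ 1, with k ∈ ℂ the square root of ζ with Im k > 0, the integral operator with kernel −e^{ik|x−y|}/(2ik) − i/(2k) + |x−y|/2 is bounded from L²_σ(ℝ) to L²_{−σ}(ℝ) with operator norm at most C|ζ|^{1/2}. (Equivalently, the free Schrödinger resolvent R₀(ζ) satisfies the low-energy expansion R₀(ζ) = A₀ζ^{−1/2} + A₁ + O(ζ^{1/2}) in L(L²_σ, L²_{−σ}), where A₀ is the operator with constant kernel i/2 and A₁ has kernel −|x−y|/2.) -/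
noncomputable section

open MeasureTheory
open scoped ENNReal NNReal

/-- The second-order Taylor remainder of `exp` is quadratically bounded on the closed
left half-plane. -/
theorem norm_exp_sub_one_sub_self_le_of_re_nonpos {z : ℂ} (hz : z.re ≤ 0) :
    ‖Complex.exp z - 1 - z‖ ≤ 3 * ‖z‖ ^ 2 := by
  rcases le_total ‖z‖ 1 with h | h
  · have := Complex.norm_exp_sub_one_sub_id_le h
    nlinarith [sq_nonneg ‖z‖]
  · have h1 : ‖Complex.exp z‖ ≤ 1 := by
      rw [Complex.norm_exp]
      exact Real.exp_le_one_iff.2 hz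
    have h2 : ‖Complex.exp z - 1 - z‖ ≤ ‖Complex.exp z‖ + ‖(1 : ℂ)‖ + ‖z‖ :=
      (norm_sub_le _ _).trans (by gcongr; exact norm_sub_le _ _)
    rw [norm_one] at h2
    nlinarith

/-- Pointwise bound for the remainder kernel of the free resolvent. -/
theorem norm_resolvent_remainder_kernel_le {k : ℂ} (hk : 0 < k.im) (x y : ℝ) :
    ‖-(Complex.exp (Complex.I * k * (|x - y| : ℝ))) / (2 * Complex.I * k)
        - Complex.I / (2 * k) + (|x - y| : ℝ) / 2‖ ≤ 3 * ‖k‖ * ((1 + x ^ 2) * (1 + y ^ 2)) := by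
  have hk0 : k ≠ 0 := by
    rintro rfl
    simp at hk
  set z : ℂ := Complex.I * k * (|x - y| : ℝ) with hz
  have hre : z.re ≤ 0 := by
    simp only [hz, Complex.mul_re, Complex.mul_im, Complex.I_re, Complex.I_im, Complex.ofReal_re,
      Complex.ofReal_im]
    nlinarith [mul_nonneg hk.le (abs_nonneg (x - y))]
  have hI : Complex.I ^ 2 = -1 := Complex.I_sq
  have heq : -(Complex.exp z) / (2 * Complex.I * k) - Complex.I / (2 * k) + (|x - y| : ℝ) / 2
      = Complex.I / (2 * k) * (Complex.exp z - 1 - z) := by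
    rw [show -(Complex.exp z) / (2 * Complex.I * k) = Complex.I / (2 * k) * Complex.exp z by
      field_simp; rw [hI]]
    have : Complex.I / (2 * k) * z = -((|x - y| : ℝ) / 2) := by
      rw [hz]; field_simp; rw [hI]; ring
    rw [mul_sub, this]
    ring
  have hnz : ‖z‖ = ‖k‖ * |x - y| := by simp [hz]
  have hkpos : 0 < ‖k‖ := norm_pos_iff.2 hk0
  have hxy : |x - y| ^ 2 ≤ 2 * ((1 + x ^ 2) * (1 + y ^ 2)) := by
    rw [sq_abs]
    nlinarith [sq_nonneg (x + y), sq_nonneg (x * y)]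
  rw [heq, norm_mul]
  calc ‖Complex.I / (2 * k)‖ * ‖Complex.exp z - 1 - z‖
      ≤ ‖Complex.I / (2 * k)‖ * (3 * ‖z‖ ^ 2) := by
        gcongr
        exact norm_exp_sub_one_sub_self_le_of_re_nonpos hre
    _ = 3 / 2 * ‖k‖ * |x - y| ^ 2 := by
        rw [hnz, norm_div, norm_mul, Complex.norm_I, Complex.norm_ofNat]
        field_simp
    _ ≤ 3 / 2 * ‖k‖ * (2 * ((1 + x ^ 2) * (1 + y ^ 2))) := by gcongr
    _ = 3 * ‖k‖ * ((1 + x ^ 2) * (1 + y ^ 2)) := by ring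

/-- The Japanese bracket `(1 + x²)^s` has finite integral over `ℝ` when `s < -1/2`. -/
theorem lintegral_one_add_sq_rpow_lt_top {s : ℝ} (hs : s < -1 / 2) :
    ∫⁻ x : ℝ, ENNReal.ofReal ((1 + x ^ 2) ^ s) < ∞ := by
  have h := integrable_rpow_neg_one_add_norm_sq (E := ℝ) (μ := volume) (r := -2 * s)
    (by simp; linarith)
  have h' : Integrable fun x : ℝ => (1 + x ^ 2) ^ s := by
    convert h using 3 with x
    · simp
    · ring
  exact h'.lintegral_lt_top

/-- Weighted Cauchy-Schwarz inequality for the first moment against `1 + y²`. -/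
theorem lintegral_one_add_sq_mul_enorm_le (σ : ℝ) {f : ℝ → ℂ} (hf : Measurable f) :
    ∫⁻ y : ℝ, ENNReal.ofReal (1 + y ^ 2) * ‖f y‖ₑ ≤
      (∫⁻ y : ℝ, ENNReal.ofReal ((1 + y ^ 2) ^ (2 - σ))) ^ (1 / 2 : ℝ) *
        (∫⁻ y : ℝ, ENNReal.ofReal ((1 + y ^ 2) ^ σ) * ‖f y‖ₑ ^ 2) ^ (1 / 2 : ℝ) := by
  have hsq : ∀ (y a : ℝ),
      ENNReal.ofReal ((1 + y ^ 2) ^ (a / 2)) ^ (2 : ℝ) = ENNReal.ofReal ((1 + y ^ 2) ^ a) := by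
    intro y a
    rw [ENNReal.ofReal_rpow_of_nonneg (by positivity) (by norm_num),
      ← Real.rpow_mul (by positivity)]
    congr 2
    ring
  have h := ENNReal.lintegral_mul_le_Lp_mul_Lq volume Real.HolderConjugate.two_two
    (f := fun y : ℝ => ENNReal.ofReal ((1 + y ^ 2) ^ ((2 - σ) / 2)))
    (g := fun y : ℝ => ENNReal.ofReal ((1 + y ^ 2) ^ (σ / 2)) * ‖f y‖ₑ)
    (by fun_prop) (by fun_prop)
  simp only [ENNReal.mul_rpow_of_nonneg _ _ (zero_le_two : (0 : ℝ) ≤ 2), hsq,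
    ENNReal.rpow_two] at h
  refine le_trans (le_of_eq (lintegral_congr fun y => ?_)) h
  simp only [Pi.mul_apply]
  rw [← mul_assoc, ← ENNReal.ofReal_mul (by positivity), ← Real.rpow_add (by positivity),
    show (2 - σ) / 2 + σ / 2 = 1 by ring, Real.rpow_one]

/-- Low-energy expansion of the free 1D Schrödinger resolvent: for `σ > 5/2`, the
integral operator with kernel `−e^{ik|x−y|}/(2ik) − i/(2k) + |x−y|/2` (where `k² = ζ`,
`Im k > 0`, `ζ ∉ [0,∞)`, `0 < |ζ| ≤ 1`) is bounded from `L²_σ` to `L²_{−σ}` with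
operator norm at most `C|ζ|^{1/2}`; i.e. `R₀(ζ) = A₀ζ^{−1/2} + A₁ + O(ζ^{1/2})`. -/
theorem free_resolvent_low_energy_expansion (σ : ℝ) (hσ : 5 / 2 < σ) :
    ∃ C : ℝ, 0 < C ∧ ∀ ζ k : ℂ,
      (∀ r : ℝ, 0 ≤ r → ζ ≠ (r : ℂ)) → ‖ζ‖ ≤ 1 → k ^ 2 = ζ → 0 < k.im →
      ∀ f : ℝ → ℂ, Measurable f →
        (∫⁻ x : ℝ, ENNReal.ofReal ((1 + x ^ 2) ^ (-σ)) *
            (‖∫ y : ℝ, (-(Complex.exp (Complex.I * k * (|x - y| : ℝ))) / (2 * Complex.I * k)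
                - Complex.I / (2 * k) + (|x - y| : ℝ) / 2) * f y‖₊ : ℝ≥0∞) ^ 2) ^ (1 / 2 : ℝ)
          ≤ ENNReal.ofReal (C * ‖ζ‖ ^ (1 / 2 : ℝ)) *
            (∫⁻ y : ℝ, ENNReal.ofReal ((1 + y ^ 2) ^ σ) * (‖f y‖₊ : ℝ≥0∞) ^ 2) ^ (1 / 2 : ℝ) := by
  set J : ℝ≥0∞ := ∫⁻ x : ℝ, ENNReal.ofReal ((1 + x ^ 2) ^ (2 - σ)) with hJ
  have hJtop : J ≠ ∞ := (lintegral_one_add_sq_rpow_lt_top (by linarith)).ne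
  refine ⟨3 * J.toReal + 1, by positivity, fun ζ k _ _ hkζ hk f hf => ?_⟩
  have hnorm : ‖ζ‖ ^ (1 / 2 : ℝ) = ‖k‖ := by
    rw [← hkζ, norm_pow, ← Real.sqrt_eq_rpow, Real.sqrt_sq (norm_nonneg k)]
  rw [hnorm]
  simp only [← enorm_eq_nnnorm]
  set N : ℝ≥0∞ := (∫⁻ y : ℝ, ENNReal.ofReal ((1 + y ^ 2) ^ σ) * ‖f y‖ₑ ^ 2) ^ (1 / 2 : ℝ)
  set S : ℝ≥0∞ := ∫⁻ y : ℝ, ENNReal.ofReal (1 + y ^ 2) * ‖f y‖ₑ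
  have hS : S ≤ J ^ (1 / 2 : ℝ) * N := lintegral_one_add_sq_mul_enorm_le σ hf
  set c : ℝ≥0∞ := ENNReal.ofReal (3 * ‖k‖) with hc
  have hpt : ∀ x : ℝ, ‖∫ y : ℝ, (-(Complex.exp (Complex.I * k * (|x - y| : ℝ))) /
      (2 * Complex.I * k) - Complex.I / (2 * k) + (|x - y| : ℝ) / 2) * f y‖ₑ ≤
        ENNReal.ofReal (1 + x ^ 2) * (c * S) := by
    intro x
    calc _ ≤ ∫⁻ y : ℝ, ‖(-(Complex.exp (Complex.I * k * (|x - y| : ℝ))) /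
            (2 * Complex.I * k) - Complex.I / (2 * k) + (|x - y| : ℝ) / 2) * f y‖ₑ :=
          enorm_integral_le_lintegral_enorm _
      _ ≤ ∫⁻ y : ℝ, ENNReal.ofReal (1 + x ^ 2) * c *
            (ENNReal.ofReal (1 + y ^ 2) * ‖f y‖ₑ) := by
          refine lintegral_mono fun y => ?_
          rw [enorm_mul, ← mul_assoc]
          refine mul_le_mul_left ?_ _
          rw [hc, ← ENNReal.ofReal_mul (by positivity), ← ENNReal.ofReal_mul (by positivity),
            ← ofReal_norm]
          refine ENNReal.ofReal_le_ofReal ((norm_resolvent_remainder_kernel_le hk x y).trans_eq ?_)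
          ring
      _ = ENNReal.ofReal (1 + x ^ 2) * (c * S) := by
          rw [lintegral_const_mul _ (by fun_prop), mul_assoc]
  have hint : (∫⁻ x : ℝ, ENNReal.ofReal ((1 + x ^ 2) ^ (-σ)) *
      ‖∫ y : ℝ, (-(Complex.exp (Complex.I * k * (|x - y| : ℝ))) / (2 * Complex.I * k)
        - Complex.I / (2 * k) + (|x - y| : ℝ) / 2) * f y‖ₑ ^ 2) ≤ J * (c * S) ^ 2 := by
    rw [hJ, ← lintegral_mul_const _ (by fun_prop)]
    refine lintegral_mono fun x => ?_
    refine (mul_le_mul_right (pow_le_pow_left' (hpt x) 2) _).trans_eq ?_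
    rw [mul_pow, ← mul_assoc, ← ENNReal.ofReal_pow (by positivity),
      ← ENNReal.ofReal_mul (by positivity), ← Real.rpow_natCast (1 + x ^ 2) 2,
      ← Real.rpow_add (by positivity)]
    congr 3
    push_cast
    ring_nf
  have hJJ : J ^ (1 / 2 : ℝ) * J ^ (1 / 2 : ℝ) = J := by
    rw [← ENNReal.rpow_add_of_nonneg _ _ (by norm_num) (by norm_num)]
    norm_num
  calc _ ≤ (J * (c * S) ^ 2) ^ (1 / 2 : ℝ) := ENNReal.rpow_le_rpow hint (by norm_num)
    _ = J ^ (1 / 2 : ℝ) * (c * S) := by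
        rw [ENNReal.mul_rpow_of_nonneg _ _ (by norm_num), ← ENNReal.rpow_natCast,
          ← ENNReal.rpow_mul]
        norm_num
    _ ≤ J ^ (1 / 2 : ℝ) * (c * (J ^ (1 / 2 : ℝ) * N)) := by gcongr
    _ = c * (J ^ (1 / 2 : ℝ) * J ^ (1 / 2 : ℝ)) * N := by ring
    _ = ENNReal.ofReal (3 * ‖k‖ * J.toReal) * N := by
        rw [hJJ, hc, ENNReal.ofReal_mul (p := 3 * ‖k‖) (by positivity),
          ENNReal.ofReal_toReal hJtop]
    _ ≤ ENNReal.ofReal ((3 * J.toReal + 1) * ‖k‖) * N := by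
        refine mul_le_mul_left (ENNReal.ofReal_le_ofReal ?_) N
        nlinarith [norm_nonneg k]
end
end

section
/- Let m > 0 and σ > 1/2. There exists a constant C > 0 such that for every ω ∈ ℂ with ω² − m² ∉ [0,∞) and |ω| ≥ 2m, the integral operator with matrix kernel K_ω(x−y) := −(i/2) sgn(x−y) α e^{ik|x−y|} + i(mβ + ωI) e^{ik|x−y|}/(2k) (where k² = ω² − m², Im k > 0) is bounded from L²_σ(ℝ; ℂ²) to L²_{−σ}(ℝ; ℂ²) with operator norm at most C. (This is the uniform high-energy bound ‖R₀(ω)‖_{L(L²_σ, L²_{−σ})} = O(1), |ω| → ∞, for the free Dirac resolvent.) -/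
noncomputable section

open MeasureTheory
open scoped ENNReal NNReal

/-- The Dirac matrix `α = [[-1,0],[0,1]]`. -/
def Mα : Matrix (Fin 2) (Fin 2) ℂ := !![-1, 0; 0, 1]

/-- The Dirac matrix `β = [[0,1],[1,0]]`. -/
def Mβ : Matrix (Fin 2) (Fin 2) ℂ := !![0, 1; 1, 0]

/-- The free Dirac resolvent matrix kernel
`K_ω(z) = −(i/2) sgn(z) α e^{ik|z|} + i(mβ + ωI) e^{ik|z|}/(2k)`. -/
def Kker (m : ℝ) (ω k : ℂ) (z : ℝ) : Matrix (Fin 2) (Fin 2) ℂ :=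
  (-(Complex.I / 2) * (Real.sign z : ℂ) * Complex.exp (Complex.I * k * (|z| : ℝ))) • Mα
    + (Complex.I * Complex.exp (Complex.I * k * (|z| : ℝ)) / (2 * k)) •
      ((m : ℂ) • Mβ + ω • (1 : Matrix (Fin 2) (Fin 2) ℂ))

theorem norm_Kker_mulVec_le {m : ℝ} (hm : 0 < m) {ω k : ℂ} (hω : 2 * m ≤ ‖ω‖)
    (hk : k ^ 2 = ω ^ 2 - (m : ℂ) ^ 2) (hk0 : 0 < k.im) (z : ℝ) (v : Fin 2 → ℂ) :
    ‖(Kker m ω k z).mulVec v‖ ≤ 2 * ‖v‖ := by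
  have hkpos : 0 < ‖k‖ := norm_pos_iff.mpr fun h => by simp [h] at hk0
  have hksq : ‖ω‖ ^ 2 - m ^ 2 ≤ ‖k‖ ^ 2 := by
    rw [← norm_pow k, hk, ← norm_pow ω]
    have h := norm_sub_norm_le (ω ^ 2) ((m : ℂ) ^ 2)
    rwa [norm_pow (m : ℂ), Complex.norm_real, Real.norm_of_nonneg hm.le] at h
  have hmk : m + ‖ω‖ ≤ 2 * ‖k‖ := by nlinarith
  have hexp : ‖Complex.exp (Complex.I * k * (|z| : ℝ))‖ ≤ 1 := by
    rw [Complex.norm_exp, Real.exp_le_one_iff]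
    simp only [Complex.mul_re, Complex.I_re, Complex.I_im, Complex.mul_im, Complex.ofReal_re,
      Complex.ofReal_im]
    nlinarith [mul_nonneg hk0.le (abs_nonneg z)]
  have hsign : ‖(Real.sign z : ℂ)‖ ≤ 1 := by
    rcases Real.sign_apply_eq z with h | h | h <;> simp [h]
  set e := Complex.exp (Complex.I * k * (|z| : ℝ)) with he
  have ha : ‖-(Complex.I / 2) * (Real.sign z : ℂ) * e‖ ≤ 1 := by
    have := mul_le_one₀ hsign (norm_nonneg e) hexp
    simp only [norm_mul, norm_neg, norm_div, Complex.norm_I, Complex.norm_ofNat]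
    nlinarith
  have hb : ‖Complex.I * e / (2 * k)‖ * (m + ‖ω‖) ≤ 1 := by
    simp only [norm_mul, norm_div, Complex.norm_I, Complex.norm_ofNat, one_mul]
    calc ‖e‖ / (2 * ‖k‖) * (m + ‖ω‖) ≤ 1 / (2 * ‖k‖) * (2 * ‖k‖) := by gcongr
      _ = 1 := by field_simp
  have key : ∀ a b s p q : ℂ, ‖a‖ ≤ 1 → ‖b‖ * (m + ‖ω‖) ≤ 1 → ‖s‖ = 1 → ‖p‖ ≤ ‖v‖ →
      ‖q‖ ≤ ‖v‖ → ‖a * (s * p) + b * (m * q + ω * p)‖ ≤ 2 * ‖v‖ := by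
    intro a b s p q ha hb hs hp hq
    calc ‖a * (s * p) + b * (m * q + ω * p)‖
        ≤ ‖a‖ * (‖s‖ * ‖p‖) + ‖b‖ * (‖(m : ℂ)‖ * ‖q‖ + ‖ω‖ * ‖p‖) := by
          refine (norm_add_le _ _).trans ?_
          rw [norm_mul, norm_mul, norm_mul b, ← norm_mul (m : ℂ), ← norm_mul ω]
          gcongr
          exact norm_add_le _ _
      _ ≤ 1 * (1 * ‖v‖) + ‖b‖ * (m * ‖v‖ + ‖ω‖ * ‖v‖) := by
          rw [hs, Complex.norm_real, Real.norm_of_nonneg hm.le]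
          gcongr
      _ = ‖v‖ + ‖b‖ * (m + ‖ω‖) * ‖v‖ := by ring
      _ ≤ 2 * ‖v‖ := by nlinarith [norm_nonneg v]
  refine (pi_norm_le_iff_of_nonneg (by positivity)).mpr fun i => ?_
  fin_cases i
  · refine le_of_eq_of_le (congrArg norm ?_) <|
      key _ _ (-1) (v 0) (v 1) ha hb (by simp) (norm_le_pi_norm v 0)
      (norm_le_pi_norm v 1)
    simp [Kker, Mα, Mβ, Matrix.mulVec, dotProduct, Fin.sum_univ_two, ← he]
    ring
  · refine le_of_eq_of_le (congrArg norm ?_) <|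
      key _ _ 1 (v 1) (v 0) ha hb (by simp) (norm_le_pi_norm v 1)
      (norm_le_pi_norm v 0)
    simp [Kker, Mα, Mβ, Matrix.mulVec, dotProduct, Fin.sum_univ_two, ← he]
    ring

theorem lintegral_one_add_sq_rpow_neg_lt_top {σ : ℝ} (hσ : 1 / 2 < σ) :
    ∫⁻ x : ℝ, ENNReal.ofReal ((1 + x ^ 2) ^ (-σ)) < ∞ := by
  have h := integrable_rpow_neg_one_add_norm_sq (E := ℝ) (μ := volume) (r := 2 * σ)
    (by simp; linarith)
  have h2 : Integrable fun x : ℝ => (1 + x ^ 2) ^ (-σ) := by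
    convert h using 3
    · simp
    · ring
  exact h2.lintegral_lt_top

/-- Cauchy–Schwarz: weighted `L²` controls `L¹`. -/
theorem lintegral_enorm_le_weighted {E : Type*} [NormedAddCommGroup E] [MeasurableSpace E]
    [OpensMeasurableSpace E] (σ : ℝ) {f : ℝ → E} (hf : Measurable f) :
    ∫⁻ y, ‖f y‖ₑ ≤ (∫⁻ x : ℝ, ENNReal.ofReal ((1 + x ^ 2) ^ (-σ))) ^ (1 / 2 : ℝ) *
      (∫⁻ y : ℝ, ENNReal.ofReal ((1 + y ^ 2) ^ σ) * ‖f y‖ₑ ^ 2) ^ (1 / 2 : ℝ) := by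
  have hsq : ∀ x s : ℝ,
      ENNReal.ofReal ((1 + x ^ 2) ^ (s / 2)) ^ 2 = ENNReal.ofReal ((1 + x ^ 2) ^ s) := by
    intro x s
    rw [← ENNReal.ofReal_pow (by positivity), ← Real.rpow_natCast, ← Real.rpow_mul (by positivity)]
    norm_num
  have h := ENNReal.lintegral_mul_le_Lp_mul_Lq volume Real.HolderConjugate.two_two
    (f := fun x : ℝ => ENNReal.ofReal ((1 + x ^ 2) ^ (-σ / 2)))
    (g := fun x : ℝ => ENNReal.ofReal ((1 + x ^ 2) ^ (σ / 2)) * ‖f x‖ₑ)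
    (by fun_prop) (by fun_prop)
  simp only [ENNReal.rpow_ofNat, mul_pow, hsq, Pi.mul_apply] at h
  refine le_of_eq_of_le (lintegral_congr fun x => ?_) h
  rw [← mul_assoc, ← ENNReal.ofReal_mul (by positivity), ← Real.rpow_add (by positivity)]
  simp [neg_div]

/-- Uniform high-energy bound for the free 1D Dirac resolvent: for `m > 0` and
`σ > 1/2`, the integral operator with kernel `K_ω(x−y)` (with `ω² − m² ∉ [0,∞)`,
`|ω| ≥ 2m`, `k² = ω² − m²`, `Im k > 0`) is bounded from `L²_σ(ℝ;ℂ²)` to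
`L²_{−σ}(ℝ;ℂ²)` with operator norm at most `C`. -/
theorem free_dirac_resolvent_high_energy_bound (m : ℝ) (hm : 0 < m)
    (σ : ℝ) (hσ : 1 / 2 < σ) :
    ∃ C : ℝ, 0 < C ∧ ∀ ω k : ℂ,
      (∀ r : ℝ, 0 ≤ r → ω ^ 2 - (m : ℂ) ^ 2 ≠ (r : ℂ)) → 2 * m ≤ ‖ω‖ →
      k ^ 2 = ω ^ 2 - (m : ℂ) ^ 2 → 0 < k.im →
      ∀ f : ℝ → Fin 2 → ℂ, Measurable f →
        (∫⁻ x : ℝ, ENNReal.ofReal ((1 + x ^ 2) ^ (-σ)) *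
            (‖∫ y : ℝ, (Kker m ω k (x - y)).mulVec (f y)‖₊ : ℝ≥0∞) ^ 2) ^ (1 / 2 : ℝ)
          ≤ ENNReal.ofReal C *
            (∫⁻ y : ℝ, ENNReal.ofReal ((1 + y ^ 2) ^ σ) * (‖f y‖₊ : ℝ≥0∞) ^ 2) ^ (1 / 2 : ℝ) := by
  set J := ∫⁻ x : ℝ, ENNReal.ofReal ((1 + x ^ 2) ^ (-σ)) with hJ
  have hJt : J < ∞ := lintegral_one_add_sq_rpow_neg_lt_top hσ
  refine ⟨2 * J.toReal + 1, by positivity, fun ω k _ hω hk hk0 f hf => ?_⟩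
  simp only [← enorm_eq_nnnorm]
  set N := (∫⁻ y : ℝ, ENNReal.ofReal ((1 + y ^ 2) ^ σ) * ‖f y‖ₑ ^ 2) ^ (1 / 2 : ℝ)
  have hpt : ∀ x : ℝ, ‖∫ y : ℝ, (Kker m ω k (x - y)).mulVec (f y)‖ₑ
      ≤ 2 * (J ^ (1 / 2 : ℝ) * N) := fun x =>
    calc ‖∫ y : ℝ, (Kker m ω k (x - y)).mulVec (f y)‖ₑ
        ≤ ∫⁻ y, ‖(Kker m ω k (x - y)).mulVec (f y)‖ₑ := enorm_integral_le_lintegral_enorm _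
      _ ≤ ∫⁻ y, 2 * ‖f y‖ₑ := lintegral_mono fun y => by
          have h := ENNReal.ofReal_le_ofReal (norm_Kker_mulVec_le hm hω hk hk0 (x - y) (f y))
          rwa [ENNReal.ofReal_mul (by norm_num), ofReal_norm, ofReal_norm,
            ENNReal.ofReal_ofNat] at h
      _ = 2 * ∫⁻ y, ‖f y‖ₑ := lintegral_const_mul' _ _ (by simp)
      _ ≤ 2 * (J ^ (1 / 2 : ℝ) * N) := by
          gcongr
          exact lintegral_enorm_le_weighted σ hf
  have hhalf : ∀ t : ℝ≥0∞, (t ^ 2) ^ (1 / 2 : ℝ) = t := fun t => by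
    rw [← ENNReal.rpow_natCast, ← ENNReal.rpow_mul]
    norm_num
  calc (∫⁻ x : ℝ, ENNReal.ofReal ((1 + x ^ 2) ^ (-σ)) *
          ‖∫ y : ℝ, (Kker m ω k (x - y)).mulVec (f y)‖ₑ ^ 2) ^ (1 / 2 : ℝ)
      ≤ (∫⁻ x : ℝ, ENNReal.ofReal ((1 + x ^ 2) ^ (-σ)) *
          (2 * (J ^ (1 / 2 : ℝ) * N)) ^ 2) ^ (1 / 2 : ℝ) := by
        gcongr with x
        exact hpt x
    _ = J ^ (1 / 2 : ℝ) * (2 * (J ^ (1 / 2 : ℝ) * N)) := by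
        rw [lintegral_mul_const _ (by fun_prop), ← hJ,
          ENNReal.mul_rpow_of_nonneg _ _ (by norm_num), hhalf]
    _ = 2 * (J ^ (1 / 2 : ℝ) * J ^ (1 / 2 : ℝ)) * N := by ring
    _ = 2 * J * N := by
        rw [← sq, ← ENNReal.rpow_natCast, ← ENNReal.rpow_mul]
        norm_num
    _ ≤ ENNReal.ofReal (2 * J.toReal + 1) * N := by
        gcongr
        rw [← ENNReal.ofReal_toReal (a := 2 * J) (by finiteness)]
        refine ENNReal.ofReal_le_ofReal ?_
        simp
end
end
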